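/- arXiv:0711.0471 — 2 statements merged into one kernel-verified Lean document; each statement's English description precedes it below -/
import Mathlib

section
/- Let {X_n} be a stationary and ergodic time series with values in a finite or countably infinite set 𝒳. Then the one-sided process {X̃_n}_{n≤0}, defined as a function of X_0^∞ by X̃_{−i} = X_{ζ_{J(i)}−i}, has the same distribution as {X_n}_{n≤0}. -/
open MeasureTheory Filter Set
open scoped ENNReal Topology

noncomputable section

namespace MWPrediction

/-- The canonical two-sided path space for a process with values in `𝒳`. -/
abbrev Path (𝒳 : Type*) := ℤ → 𝒳

variable {𝒳 : Type*}

/-- The left shift `(T ω) i = ω (i+1)` on two-sided sequences. -/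
def shift (ω : Path 𝒳) : Path 𝒳 := fun i => ω (i + 1)

/-- The one-sided past `X⁰_{-∞}`, recorded as `past ω i = X_{-i}`. -/
def past (ω : Path 𝒳) : ℕ → 𝒳 := fun i => ω (-(i : ℤ))

/-- The string `s` of length `m` (read right-to-left: `s j` is the symbol at
position `t - j`) occurs in `ω` ending at time `t`. -/
def OccursAt (ω : Path 𝒳) (m : ℕ) (s : ℕ → 𝒳) (t : ℤ) : Prop :=
  ∀ j < m, ω (t - (j : ℤ)) = s j

/-- The auxiliary stopping times `ζ_n`:  `ζ_0 = 0` and `ζ_n` is obtained from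
`ζ_{n-1}` by waiting for the recurrence of the block of length `l n` ending
at `ζ_{n-1}`. -/
def zeta (l : ℕ → ℕ) (ω : Path 𝒳) : ℕ → ℤ
  | 0 => 0
  | n + 1 =>
    zeta l ω n +
      ((sInf {t : ℕ | 0 < t ∧ ∀ s < l (n + 1),
          ω (zeta l ω n - (s : ℤ) + (t : ℤ)) = ω (zeta l ω n - (s : ℤ))} : ℕ) : ℤ)

/-- `J n = min { j ≥ 1 : l (j+1) > n }`. -/
def Jfun (l : ℕ → ℕ) (n : ℕ) : ℕ := sInf {j : ℕ | 1 ≤ j ∧ n < l (j + 1)}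

/-- The auxiliary process `X̃`: `tildePast l ω i = X̃_{-i} = X_{ζ_{J(i)} - i}`. -/
def tildePast (l : ℕ → ℕ) (ω : Path 𝒳) : ℕ → 𝒳 :=
  fun i => ω (zeta l ω (Jfun l i) - (i : ℤ))

variable [MeasurableSpace 𝒳]

/-- `pstr μ m s = P(X_{-m+1}^0 = s)`, the probability that the string `s` of
length `m` (read right-to-left) occupies positions `-m+1, …, 0`.
(So `pstr μ (k+1)` is `p_k` of the paper.) -/
def pstr (μ : Measure (Path 𝒳)) (m : ℕ) (s : ℕ → 𝒳) : ℝ :=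
  (μ {ω | ∀ j < m, ω (-(j : ℤ)) = s j}).toReal

/-- `pcond μ m y s = P(X_1 = y | X_{-m+1}^0 = s)`, conditioning on `m` symbols.
(So `pcond μ m` is `p_{m-1}(·|·)` of the paper.) -/
def pcond (μ : Measure (Path 𝒳)) (m : ℕ) (y : 𝒳) (s : ℕ → 𝒳) : ℝ :=
  (μ {ω | ω 1 = y ∧ ∀ j < m, ω (-(j : ℤ)) = s j}).toReal / pstr μ m s

/-- Append `y` as the new rightmost symbol of the string `s`. -/
def withLast (y : 𝒳) (s : ℕ → 𝒳) : ℕ → 𝒳 := fun j => if j = 0 then y else s (j - 1)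

/-- The string which agrees with `b` on its rightmost `k` symbols and continues
to the left with `z`:  this is the string `(z, b_{-k+1}^0)` of the paper. -/
def prependOld (b : ℕ → 𝒳) (k : ℕ) (z : ℕ → 𝒳) : ℕ → 𝒳 :=
  fun j => if j < k then b j else z (j - k)

/-- `K` is a memory bound for the past `b`: for all `i ≥ 1`, `y` and `z ∈ 𝒳^i`,
if `p_{K+i}(z, b_{-K+1}^0, y) > 0` then
`p_{K-1}(y | b_{-K+1}^0) = p_{K+i-1}(y | z, b_{-K+1}^0)`. -/
def IsMemoryBound (μ : Measure (Path 𝒳)) (b : ℕ → 𝒳) (K : ℕ) : Prop :=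
  ∀ i : ℕ, 1 ≤ i → ∀ y : 𝒳, ∀ z : ℕ → 𝒳,
    0 < pstr μ (K + i + 1) (withLast y (prependOld b K z)) →
    pcond μ K y b = pcond μ (K + i) y (prependOld b K z)

/-- The (random) memory length `K(b)` of a one-sided path `b`: the smallest
memory bound, and `∞` if there is none. -/
def memLen (μ : Measure (Path 𝒳)) (b : ℕ → 𝒳) : ℕ∞ :=
  sInf {n : ℕ∞ | ∃ K : ℕ, n = (K : ℕ∞) ∧ IsMemoryBound μ b K}

/-- `Δ_k(b_{-k+1}^0)`. -/
def Delta (μ : Measure (Path 𝒳)) (k : ℕ) (b : ℕ → 𝒳) : ℝ :=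
  sSup {d : ℝ | ∃ i : ℕ, 1 ≤ i ∧ ∃ z : ℕ → 𝒳, ∃ x : 𝒳,
    0 < pstr μ (k + i + 1) (withLast x (prependOld b k z)) ∧
    d = |pcond μ k x b - pcond μ (k + i) x (prependOld b k z)|}

/-- `⌈n/2⌉`. -/
def half (n : ℕ) : ℕ := (n + 1) / 2

open Classical in
/-- The number of times `t ∈ [a, b]` at which the string `s` of length `m`
occurs in `ω` ending at `t`. -/
def cnt (ω : Path 𝒳) (m : ℕ) (s : ℕ → 𝒳) (a b : ℤ) : ℕ :=
  ((Finset.Icc a b).filter fun t => OccursAt ω m s t).card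

/-- Membership in `ℒ_{n,m}^{(1)}`: the string `s` of length `m+1` occurs in
`X_0^{⌈n/2⌉ - 1}`. -/
def inL1 (ω : Path 𝒳) (n m : ℕ) (s : ℕ → 𝒳) : Prop :=
  ∃ t : ℤ, (m : ℤ) ≤ t ∧ t ≤ (half n : ℤ) - 1 ∧ OccursAt ω (m + 1) s t

/-- Membership in `ℒ_{n,m}^{(2)}`: the string `s` of length `m+1` occurs more
than `n^{1-γ}` times in `X_{⌈n/2⌉}^n`. -/
def inL2 (γ : ℝ) (ω : Path 𝒳) (n m : ℕ) (s : ℕ → 𝒳) : Prop :=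
  (n : ℝ) ^ (1 - γ) < (cnt ω (m + 1) s ((half n : ℤ) + (m : ℤ)) (n : ℤ) : ℝ)

/-- Membership in `ℒ_m^n = ℒ_{n,m}^{(1)} ∩ ℒ_{n,m}^{(2)}`. -/
def inL (γ : ℝ) (ω : Path 𝒳) (n m : ℕ) (s : ℕ → 𝒳) : Prop :=
  inL1 ω n m s ∧ inL2 γ ω n m s

/-- The empirical conditional relative frequency of `x` following the string
`s` of length `m`, computed in the second half `X_{⌈n/2⌉}^n` of the data. -/
def empCond (ω : Path 𝒳) (n m : ℕ) (x : 𝒳) (s : ℕ → 𝒳) : ℝ :=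
  (cnt ω (m + 1) (withLast x s) ((half n : ℤ) + (m : ℤ)) (n : ℤ) : ℝ) /
    (cnt ω m s ((half n : ℤ) + (m : ℤ) - 1) ((n : ℤ) - 1) : ℝ)

/-- The empirical statistic `Δ̂_k^n(X̃_{-k+1}^0)`. -/
def hatDelta (γ : ℝ) (l : ℕ → ℕ) (ω : Path 𝒳) (n k : ℕ) : ℝ :=
  (if zeta l ω (Jfun l k) ≤ (half n : ℤ) - 1 then (1 : ℝ) else 0) *
    sSup {d : ℝ | ∃ i : ℕ, 1 ≤ i ∧ i ≤ n ∧ ∃ z : ℕ → 𝒳, ∃ x : 𝒳,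
      inL γ ω n (k + i) (withLast x (prependOld (tildePast l ω) k z)) ∧
      d = |empCond ω n k x (tildePast l ω) -
            empCond ω n (k + i) x (prependOld (tildePast l ω) k z)|}

/-- The order estimate `χ_n`: the smallest `0 ≤ k < n` with `Δ̂_k^n ≤ n^{-β}`
(and `χ_0 = 0`). -/
def chi (β γ : ℝ) (l : ℕ → ℕ) (ω : Path 𝒳) (n : ℕ) : ℕ :=
  sInf {k : ℕ | k < n ∧ hatDelta γ l ω n k ≤ (n : ℝ) ^ (-β)}

/-- The index `j` with `ζ_j ≤ v < ζ_{j+1}`. -/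
def jIndex (l : ℕ → ℕ) (ω : Path 𝒳) (v : ℤ) : ℕ := sInf {j : ℕ | v < zeta l ω (j + 1)}

/-- The stopping times `λ_n`:  `λ_0 = 0` and, if `ζ_j ≤ λ_{n-1} < ζ_{j+1}`,
`λ_n = min { t > λ_{n-1} : X_{t - χ_t + 1}^t = X_{ζ_j - χ_t + 1}^{ζ_j} }`. -/
def lambda (β γ : ℝ) (l : ℕ → ℕ) (ω : Path 𝒳) : ℕ → ℤ
  | 0 => 0
  | n + 1 =>
    lambda β γ l ω n + 1 +
      ((sInf {s : ℕ |
          ∀ r < chi β γ l ω (lambda β γ l ω n + 1 + (s : ℤ)).toNat,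
            ω (lambda β γ l ω n + 1 + (s : ℤ) - (r : ℤ)) =
              ω (zeta l ω (jIndex l ω (lambda β γ l ω n)) - (r : ℤ))} : ℕ) : ℤ)

/-- `κ_n = χ_{λ_n}`. -/
def kappa (β γ : ℝ) (l : ℕ → ℕ) (ω : Path 𝒳) (n : ℕ) : ℕ :=
  chi β γ l ω (lambda β γ l ω n).toNat

/-- The estimator `f_n = (1/n) ∑_{j=0}^{n-1} f(X_{λ_j + 1})`. -/
def fEst (β γ : ℝ) (l : ℕ → ℕ) (f : 𝒳 → ℝ) (ω : Path 𝒳) (n : ℕ) : ℝ :=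
  (1 / (n : ℝ)) * ∑ j ∈ Finset.range n, f (ω (lambda β γ l ω j + 1))

open Classical in
/-- The metric `d*` on one-sided sequences. -/
def dstar (x y : ℕ → 𝒳) : ℝ :=
  ∑' i : ℕ, (2 : ℝ)⁻¹ ^ (i + 1) * (if x i ≠ y i then 1 else 0)

/-- `F` restricted to `C` is continuous with respect to the metric `d*`. -/
def ContinuousOnDstar (F : (ℕ → 𝒳) → ℝ) (C : Set (ℕ → 𝒳)) : Prop :=
  ∀ x ∈ C, ∀ ε > 0, ∃ δ > 0, ∀ y ∈ C, dstar x y < δ → |F y - F x| < ε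

/-- The σ-algebra generated by the one-sided past `X^0_{-∞}`. -/
def pastSigma (𝒳 : Type*) [MeasurableSpace 𝒳] : MeasurableSpace (Path 𝒳) :=
  MeasurableSpace.comap past inferInstance

/-- `F` is a version of the conditional expectation `E(f(X_1) | X^0_{-∞})`. -/
def IsPredictor (μ : Measure (Path 𝒳)) (f : 𝒳 → ℝ) (F : (ℕ → 𝒳) → ℝ) : Prop :=
  (fun ω => F (past ω)) =ᵐ[μ] μ[fun ω => f (ω 1)|pastSigma 𝒳]

/-- `F` (a version of `E(f(X_1)|X^0_{-∞})`) is almost surely continuous: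
it is continuous w.r.t. `d*` on a set of paths of probability one. -/
def ASContinuousCondExp (μ : Measure (Path 𝒳)) (F : (ℕ → 𝒳) → ℝ) : Prop :=
  ∃ C : Set (ℕ → 𝒳), μ (past ⁻¹' C) = 1 ∧ ContinuousOnDstar F C

/-- The observation `(λ_j, X_0^{λ_j})`, encoding the data segment available at
time `λ_j` (values before time `0` are clamped to `X_0`). -/
def segObs (β γ : ℝ) (l : ℕ → ℕ) (j : ℕ) (ω : Path 𝒳) : ℤ × (ℕ → 𝒳) :=
  (lambda β γ l ω j, fun i => ω (max (lambda β γ l ω j - (i : ℤ)) 0))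

/-- The σ-algebra generated by `(λ_j, X_0^{λ_j})`. -/
def segSigma (β γ : ℝ) (l : ℕ → ℕ) (j : ℕ) : MeasurableSpace (Path 𝒳) :=
  MeasurableSpace.comap (segObs β γ l j) inferInstance

/-- The observation `(λ_j, X_{-∞}^{λ_j})`: the full past at time `λ_j`. -/
def fullPastObs (β γ : ℝ) (l : ℕ → ℕ) (j : ℕ) (ω : Path 𝒳) : ℤ × (ℕ → 𝒳) :=
  (lambda β γ l ω j, fun i => ω (lambda β γ l ω j - (i : ℤ)))

/-- The σ-algebra generated by `(λ_j, X_{-∞}^{λ_j})`. -/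
def fullPastSigma (β γ : ℝ) (l : ℕ → ℕ) (j : ℕ) : MeasurableSpace (Path 𝒳) :=
  MeasurableSpace.comap (fullPastObs β γ l j) inferInstance

/-- The `n`-th term `-(1/(n+1)) ∑ p log₂ p` of the entropy rate. -/
def entropyTerm (μ : Measure (Path 𝒳)) (n : ℕ) : ℝ :=
  -(1 / ((n : ℝ) + 1)) *
    ∑' s : Fin (n + 1) → 𝒳,
      pstr μ (n + 1) (fun j => if h : j < n + 1 then s ⟨j, h⟩ else s ⟨0, Nat.succ_pos n⟩) *
        Real.logb 2
          (pstr μ (n + 1) (fun j => if h : j < n + 1 then s ⟨j, h⟩ else s ⟨0, Nat.succ_pos n⟩))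

/-- The process has entropy rate `H`. -/
def HasEntropyRate (μ : Measure (Path 𝒳)) (H : ℝ) : Prop :=
  Tendsto (entropyTerm μ) atTop (nhds H)

/-- The backward stopping times `ζ̂_i^k`. -/
def hatZeta (l : ℕ → ℕ) (k : ℕ) (ω : Path 𝒳) : ℕ → ℤ
  | 0 => 0
  | i + 1 =>
    hatZeta l k ω i -
      ((sInf {t : ℕ | 0 < t ∧ ∀ s < l (k - i),
          ω (hatZeta l k ω i - (s : ℤ) - (t : ℤ)) = ω (hatZeta l k ω i - (s : ℤ))} : ℕ) : ℤ)


section ReturnMap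

variable {α : Type*}

/-- The shift by `z` steps on two-sided sequences. -/
def translate (z : ℤ) (ω : Path α) : Path α := fun i => ω (i + z)

/-- The first positive time at which the block of length `m` ending at time `0` recurs
(and `0` if it never does). -/
def returnTime (m : ℕ) (ω : Path α) : ℕ :=
  sInf {t : ℕ | 0 < t ∧ ∀ s < m, ω (-(s : ℤ) + (t : ℤ)) = ω (-(s : ℤ))}

/-- The shift to the first recurrence of the block of length `m` ending at time `0`. -/
def returnMap (m : ℕ) (ω : Path α) : Path α := translate (returnTime m ω) ω

lemma translate_translate (a b : ℤ) (ω : Path α) :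
    translate a (translate b ω) = translate (a + b) ω := by
  funext i
  simp [translate, add_assoc]

lemma translate_zero (ω : Path α) : translate 0 ω = ω := by
  funext i
  simp [translate]

lemma shift_iterate (n : ℕ) : (shift : Path α → Path α)^[n] = translate (n : ℤ) := by
  induction n with
  | zero => funext ω; simp [translate_zero]
  | succ n ih =>
    rw [Function.iterate_succ', ih]
    funext ω i
    simp only [Function.comp, shift, translate]
    congr 1
    push_cast
    ring

lemma returnTime_mem {m : ℕ} {ω : Path α} (h : returnTime m ω ≠ 0) {s : ℕ} (hs : s < m) :
    ω (-(s : ℤ) + (returnTime m ω : ℤ)) = ω (-(s : ℤ)) :=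
  (Nat.sInf_mem (Nat.nonempty_of_pos_sInf (Nat.pos_of_ne_zero h))).2 s hs

lemma returnMap_apply_neg {m : ℕ} (ω : Path α) {s : ℕ} (hs : s < m) :
    returnMap m ω (-(s : ℤ)) = ω (-(s : ℤ)) := by
  by_cases h : returnTime m ω = 0
  · simp [returnMap, translate, h]
  · exact returnTime_mem h hs

lemma returnTime_le {m : ℕ} {ω : Path α} {t : ℕ} (ht : 0 < t)
    (h : ∀ s < m, ω (-(s : ℤ) + (t : ℤ)) = ω (-(s : ℤ))) : returnTime m ω ≤ t :=
  Nat.sInf_le ⟨ht, h⟩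

lemma translate_zeta_succ (l : ℕ → ℕ) (ω : Path α) (n : ℕ) :
    translate (zeta l ω (n + 1)) ω = returnMap (l (n + 1)) (translate (zeta l ω n) ω) := by
  rw [returnMap, translate_translate, zeta, add_comm]
  congr 3
  simp only [returnTime, translate]
  congr 1
  ext t
  simp only [Set.mem_ofPred_eq]
  refine and_congr_right fun _ => forall₂_congr fun s _ => ?_
  rw [show zeta l ω n - (s : ℤ) + t = -(s : ℤ) + t + zeta l ω n by ring,
    show zeta l ω n - (s : ℤ) = -(s : ℤ) + zeta l ω n by ring]

/-- Distinct positive return times have disjoint images under the return map. -/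
lemma returnTime_translate_neg_unique {m : ℕ} {ω : Path α} {t u : ℕ} (ht : 0 < t) (htu : t < u)
    (h₁ : returnTime m (translate (-(t : ℤ)) ω) = t)
    (h₂ : returnTime m (translate (-(u : ℤ)) ω) = u) : False := by
  have e₁ : ∀ s < m, ω (-(s : ℤ)) = ω (-(s : ℤ) - t) := fun s hs => by
    have := returnTime_mem (by omega : returnTime m (translate (-(t : ℤ)) ω) ≠ 0) hs
    rw [h₁] at this
    simpa [translate, sub_eq_add_neg] using this
  have e₂ : ∀ s < m, ω (-(s : ℤ)) = ω (-(s : ℤ) - u) := fun s hs => by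
    have := returnTime_mem (by omega : returnTime m (translate (-(u : ℤ)) ω) ≠ 0) hs
    rw [h₂] at this
    simpa [translate, sub_eq_add_neg] using this
  have hle : returnTime m (translate (-(u : ℤ)) ω) ≤ u - t := by
    refine returnTime_le (by omega) fun s hs => ?_
    simp only [translate]
    rw [show -(s : ℤ) + ((u - t : ℕ) : ℤ) + -(u : ℤ) = -(s : ℤ) - t by omega, ← e₁ s hs, e₂ s hs]
    rfl
  omega

lemma exists_lt_level {l : ℕ → ℕ} (hltop : Tendsto l atTop atTop) (i : ℕ) :
    i < l (Jfun l i + 1) := by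
  obtain ⟨j, hj, hij⟩ := ((tendsto_atTop.1 (hltop.comp (tendsto_add_atTop_nat 1)) (i + 1)).and
    (eventually_ge_atTop 1)).exists
  exact (Nat.sInf_mem (s := {j : ℕ | 1 ≤ j ∧ i < l (j + 1)}) ⟨j, hij, hj⟩).2

lemma tildePast_eq_past_translate {l : ℕ → ℕ} (hlmono : Monotone l)
    (hltop : Tendsto l atTop atTop) (ω : Path α) {i k : ℕ} (hk : Jfun l i ≤ k) :
    tildePast l ω i = past (translate (zeta l ω k) ω) i := by
  induction k, hk using Nat.le_induction with
  | base =>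
    simp only [tildePast, past, translate]
    congr 1
    ring
  | succ k hk ih =>
    rw [ih, translate_zeta_succ, past, past, returnMap_apply_neg]
    exact (exists_lt_level hltop i).trans_le (hlmono (by omega))

section Measure

variable [MeasurableSpace α]

lemma measurable_translate (z : ℤ) : Measurable (translate z : Path α → Path α) :=
  measurable_pi_lambda _ fun _ => measurable_pi_apply _

lemma measurable_past : Measurable (past : Path α → ℕ → α) :=
  measurable_pi_lambda _ fun _ => measurable_pi_apply _

lemma measurePreserving_translate_neg {μ : Measure (Path α)}
    (hμ : MeasurePreserving (shift : Path α → Path α) μ μ) (n : ℕ) :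
    MeasurePreserving (translate (-(n : ℤ)) : Path α → Path α) μ μ := by
  refine ⟨measurable_translate _, ?_⟩
  have h := (hμ.iterate n).map_eq
  rw [shift_iterate] at h
  conv_lhs => rw [← h]
  rw [Measure.map_map (measurable_translate _) (measurable_translate _)]
  convert Measure.map_id
  funext ω
  simp [translate_translate, translate_zero]

variable [Countable α] [MeasurableSingletonClass α]

lemma measurable_returnTime (m : ℕ) : Measurable (returnTime m : Path α → ℕ) := by
  have hP : ∀ t : ℕ, MeasurableSet {ω : Path α |
      0 < t ∧ ∀ s < m, ω (-(s : ℤ) + (t : ℤ)) = ω (-(s : ℤ))} := fun t => by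
    refine (MeasurableSet.const _).inter (MeasurableSet.congr
      (MeasurableSet.iInter fun s : ℕ => MeasurableSet.iInter fun _ : s < m =>
        measurableSet_eq_fun (measurable_pi_apply (-(s : ℤ) + (t : ℤ)))
          (measurable_pi_apply (-(s : ℤ)))) ?_)
    ext ω
    simp only [Set.mem_iInter]
    rfl
  refine measurable_of_Iic fun n => ?_
  have : returnTime m ⁻¹' Iic n =
      (⋃ t ∈ Iic n, {ω : Path α | 0 < t ∧ ∀ s < m, ω (-(s : ℤ) + (t : ℤ)) = ω (-(s : ℤ))}) ∪
      ⋂ t : ℕ, {ω : Path α | 0 < t ∧ ∀ s < m, ω (-(s : ℤ) + (t : ℤ)) = ω (-(s : ℤ))}ᶜ := by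
    ext ω
    simp only [Set.mem_union, Set.mem_iInter, Set.mem_iUnion, Set.mem_preimage, Set.mem_Iic]
    constructor
    · intro h
      rcases Set.eq_empty_or_nonempty
        {t : ℕ | 0 < t ∧ ∀ s < m, ω (-(s : ℤ) + (t : ℤ)) = ω (-(s : ℤ))} with h0 | h0
      · exact Or.inr fun t ht => (h0 ▸ (show t ∈ {t : ℕ | 0 < t ∧
          ∀ s < m, ω (-(s : ℤ) + (t : ℤ)) = ω (-(s : ℤ))} from ht) : t ∈ (∅ : Set ℕ))
      · exact Or.inl ⟨_, h, Nat.sInf_mem h0⟩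
    · rintro (⟨t, ht, h⟩ | h)
      · exact (returnTime_le h.1 h.2).trans ht
      · have : {t : ℕ | 0 < t ∧ ∀ s < m, ω (-(s : ℤ) + (t : ℤ)) = ω (-(s : ℤ))} = ∅ :=
          Set.eq_empty_of_forall_notMem h
        simp [returnTime, this]
  rw [this]
  exact (MeasurableSet.biUnion (Set.to_countable _) fun t _ => hP t).union
    (MeasurableSet.iInter fun t => (hP t).compl)

lemma measurable_returnMap (m : ℕ) : Measurable (returnMap m : Path α → Path α) := by
  have h : Measurable fun p : ℕ × Path α => translate (p.1 : ℤ) p.2 :=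
    measurable_from_prod_countable_right fun n => measurable_translate (n : ℤ)
  exact h.comp ((measurable_returnTime m).prodMk measurable_id)

/-- Poincaré recurrence for blocks. -/
lemma ae_returnTime_ne_zero {μ : Measure (Path α)} [IsFiniteMeasure μ]
    (hμ : MeasurePreserving (shift : Path α → Path α) μ μ) (m : ℕ) :
    ∀ᵐ ω ∂μ, returnTime m ω ≠ 0 := by
  let C : (Fin m → α) → Set (Path α) := fun b => {ω | (fun s : Fin m => ω (-(s : ℤ))) = b}
  have hC : ∀ b, MeasurableSet (C b) := fun b =>
    (measurable_pi_lambda (fun (ω : Path α) (s : Fin m) => ω (-(s : ℤ)))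
      fun _ => measurable_pi_apply _) (measurableSet_singleton b)
  have h := ae_all_iff.2 fun b =>
    hμ.conservative.ae_mem_imp_frequently_image_mem (hC b).nullMeasurableSet
  filter_upwards [h] with ω hω
  obtain ⟨t, ht, ht'⟩ := ((hω _ rfl).and_eventually (eventually_gt_atTop 0)).exists
  rw [shift_iterate] at ht
  have hmem : t ∈ {t : ℕ | 0 < t ∧ ∀ s < m, ω (-(s : ℤ) + (t : ℤ)) = ω (-(s : ℤ))} :=
    ⟨ht', fun s hs => congrFun ht ⟨s, hs⟩⟩
  exact (Nat.sInf_mem ⟨t, hmem⟩).1.ne'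

lemma measurePreserving_returnMap {μ : Measure (Path α)} [IsProbabilityMeasure μ]
    (hμ : MeasurePreserving (shift : Path α → Path α) μ μ) (m : ℕ) :
    MeasurePreserving (returnMap m : Path α → Path α) μ μ := by
  have hmeas := measurable_returnMap (α := α) m
  refine ⟨hmeas, ?_⟩
  have := Measure.isProbabilityMeasure_map (μ := μ) hmeas.aemeasurable
  refine Measure.eq_of_le_of_isProbabilityMeasure (Measure.le_iff.2 fun A hA => ?_)
  rw [Measure.map_apply hmeas hA]
  have hR : ∀ t : ℕ, MeasurableSet {ω : Path α | returnTime m ω = t} := fun t =>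
    measurable_returnTime m (measurableSet_singleton t)
  let B : ℕ → Set (Path α) := fun t =>
    {ω | returnTime m ω = t + 1} ∩ translate ((t + 1 : ℕ) : ℤ) ⁻¹' A
  let D : ℕ → Set (Path α) := fun t =>
    translate (-((t + 1 : ℕ) : ℤ)) ⁻¹' {ω | returnTime m ω = t + 1} ∩ A
  have hB : ∀ t, MeasurableSet (B t) := fun t => (hR _).inter (measurable_translate _ hA)
  have hD : ∀ t, MeasurableSet (D t) := fun t => (measurable_translate _ (hR _)).inter hA
  have hBD : ∀ t, μ (B t) = μ (D t) := fun t => by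
    rw [← (measurePreserving_translate_neg hμ (t + 1)).measure_preimage (hB t).nullMeasurableSet]
    congr 1
    ext ω
    simp [B, D, translate_translate, translate_zero]
  have hdisj : Pairwise (Function.onFun Disjoint D) := by
    intro t u htu
    refine Set.disjoint_left.2 fun ω h₁ h₂ => ?_
    rcases lt_or_gt_of_ne htu with h | h
    · exact returnTime_translate_neg_unique t.succ_pos (Nat.succ_lt_succ h) h₁.1 h₂.1
    · exact returnTime_translate_neg_unique u.succ_pos (Nat.succ_lt_succ h) h₂.1 h₁.1
  calc μ (returnMap m ⁻¹' A) ≤ μ (⋃ t, B t) := by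
        refine measure_mono_ae ?_
        filter_upwards [ae_returnTime_ne_zero hμ m] with ω hω hA'
        obtain ⟨t, ht⟩ := Nat.exists_eq_succ_of_ne_zero hω
        refine Set.mem_iUnion.2 ⟨t, ht, ?_⟩
        have h : translate (returnTime m ω : ℤ) ω ∈ A := hA'
        rwa [ht] at h
    _ ≤ ∑' t, μ (B t) := measure_iUnion_le _
    _ = ∑' t, μ (D t) := by simp only [hBD]
    _ = μ (⋃ t, D t) := (measure_iUnion hdisj hD).symm
    _ ≤ μ A := measure_mono (Set.iUnion_subset fun t => Set.inter_subset_right)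

lemma measurePreserving_translate_zeta {μ : Measure (Path α)} [IsProbabilityMeasure μ]
    (hμ : MeasurePreserving (shift : Path α → Path α) μ μ) (l : ℕ → ℕ) (n : ℕ) :
    MeasurePreserving (fun ω : Path α => translate (zeta l ω n) ω) μ μ := by
  induction n with
  | zero =>
    simp only [zeta, translate_zero]
    exact MeasurePreserving.id μ
  | succ n ih =>
    simp only [translate_zeta_succ]
    exact (measurePreserving_returnMap hμ _).comp ih

end Measure

end ReturnMap

/-- Step 1. The process `{X̃_n}_{n ≤ 0}` has the same
distribution as `{X_n}_{n ≤ 0}`. -/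
theorem statement4
    {𝒳 : Type*} [Countable 𝒳] [MeasurableSpace 𝒳] [MeasurableSingletonClass 𝒳]
    (μ : Measure (Path 𝒳)) [IsProbabilityMeasure μ]
    (hErg : Ergodic (shift : Path 𝒳 → Path 𝒳) μ)
    (l : ℕ → ℕ) (hl1 : l 1 = 1) (hlmono : Monotone l)
    (hlle : ∀ k, 1 ≤ k → l k ≤ k) (hltop : Tendsto l atTop atTop) :
    Measure.map (tildePast l) μ = Measure.map (past : Path 𝒳 → ℕ → 𝒳) μ := by
  have hpres := measurePreserving_translate_zeta hErg.toMeasurePreserving l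
  have htilde : Measurable (tildePast l : Path 𝒳 → ℕ → 𝒳) :=
    measurable_pi_lambda _ fun i => by
      simp only [fun ω : Path 𝒳 => tildePast_eq_past_translate hlmono hltop ω (le_refl (Jfun l i))]
      exact (measurable_pi_apply i).comp (measurable_past.comp (hpres _).measurable)
  have hproj : IsProjectiveLimit (Measure.map (tildePast l) μ)
      (fun I : Finset ℕ => (Measure.map (past : Path 𝒳 → ℕ → 𝒳) μ).map I.restrict) := fun I => by
    dsimp only
    rw [Measure.map_map (Finset.measurable_restrict I) htilde]
    conv_rhs => rw [← (hpres (I.sup (Jfun l))).map_eq]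
    rw [Measure.map_map measurable_past (hpres _).measurable,
      Measure.map_map (Finset.measurable_restrict I) (measurable_past.comp (hpres _).measurable)]
    congr 1
    funext ω i
    exact tildePast_eq_past_translate hlmono hltop ω (Finset.le_sup i.2)
  have : ∀ I : Finset ℕ, IsFiniteMeasure
      ((Measure.map (past : Path 𝒳 → ℕ → 𝒳) μ).map I.restrict) := fun _ => inferInstance
  exact hproj.unique fun _ => rfl

end MWPrediction
end
end

section
/- Let {X_n} be a stationary and ergodic time series with values in a finite or countably infinite set 𝒳. Then for every fixed k, almost surely liminf_{n→∞} Δ̂_k^n ≥ Δ_k. -/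
open MeasureTheory Filter Set
open scoped ENNReal Topology

noncomputable section

namespace MWPrediction

variable {𝒳 : Type*}

variable [MeasurableSpace 𝒳]

/-- The running maximum `max (0, S₁ g, …, Sₙ g)` of the Birkhoff sums of `g`, in recursive form. -/
def birkhoffMax {α : Type*} (T : α → α) (g : α → ℝ) : ℕ → α → ℝ
  | 0 => fun _ => 0
  | n + 1 => fun x => max 0 (g x + birkhoffMax T g n (T x))

section BirkhoffMax

variable {α : Type*} {T : α → α} {g : α → ℝ}

lemma birkhoffMax_nonneg (n : ℕ) (x : α) : 0 ≤ birkhoffMax T g n x := by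
  cases n with
  | zero => exact le_rfl
  | succ n => exact le_max_left _ _

lemma birkhoffMax_le_succ (n : ℕ) (x : α) :
    birkhoffMax T g n x ≤ birkhoffMax T g (n + 1) x := by
  induction n generalizing x with
  | zero => exact birkhoffMax_nonneg 1 x
  | succ n ih => exact max_le_max le_rfl (by linarith [ih (T x)])

lemma birkhoffSum_le_birkhoffMax (n : ℕ) (x : α) :
    birkhoffSum T g n x ≤ birkhoffMax T g n x := by
  induction n generalizing x with
  | zero => simp [birkhoffMax]
  | succ n ih =>
    rw [birkhoffSum_succ']
    exact le_max_of_le_right (by linarith [ih (T x)])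

lemma birkhoffMax_le {C : ℝ} (hC : ∀ x, |g x| ≤ C) (n : ℕ) (x : α) :
    birkhoffMax T g n x ≤ n * C := by
  have hC0 : 0 ≤ C := (abs_nonneg _).trans (hC x)
  induction n generalizing x with
  | zero => simp [birkhoffMax]
  | succ n ih =>
    refine max_le (by positivity) ?_
    push_cast
    linarith [ih (T x), le_of_abs_le (hC x)]

variable [MeasurableSpace α] {μ : Measure α}

lemma measurable_birkhoffMax (hT : Measurable T) (hg : Measurable g) (n : ℕ) :
    Measurable (birkhoffMax T g n) := by
  induction n with
  | zero => exact measurable_const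
  | succ n ih => exact measurable_const.max (hg.add (ih.comp hT))

lemma measurable_birkhoffSum (hT : Measurable T) (hg : Measurable g) (n : ℕ) :
    Measurable (birkhoffSum T g n) := by
  unfold birkhoffSum
  exact Finset.measurable_sum _ fun i _ => hg.comp (hT.iterate i)

/-- A form of the maximal ergodic theorem. -/
lemma integral_nonneg_of_birkhoffSum_unbounded [IsProbabilityMeasure μ]
    (hT : MeasurePreserving T μ μ) (hg : Measurable g) {C : ℝ} (hC : ∀ x, |g x| ≤ C)
    (h : ∀ᵐ x ∂μ, ∀ N : ℕ, ∃ n, (N : ℝ) < birkhoffSum T g n x) : 0 ≤ ∫ x, g x ∂μ := by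
  have hint (n : ℕ) : Integrable (birkhoffMax T g n) μ :=
    .of_bound (measurable_birkhoffMax hT.measurable hg n).aestronglyMeasurable (n * C)
      (ae_of_all _ fun x => by
        rw [Real.norm_of_nonneg (birkhoffMax_nonneg n x)]
        exact birkhoffMax_le hC n x)
  have hintT (n : ℕ) : Integrable (fun x => birkhoffMax T g n (T x)) μ :=
    hT.integrable_comp_of_integrable (hint n)
  have hlim : Tendsto
      (fun n => ∫ x, (birkhoffMax T g (n + 1) x - birkhoffMax T g n (T x)) ∂μ) atTop
      (𝓝 (∫ x, g x ∂μ)) := by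
    refine tendsto_integral_of_dominated_convergence (fun _ => C)
      (fun n => ((hint (n + 1)).sub (hintT n)).aestronglyMeasurable) (integrable_const C) ?_ ?_
    · refine fun n => ae_of_all _ fun x => ?_
      have h0 := birkhoffMax_nonneg (T := T) (g := g) n (T x)
      obtain ⟨h1, h2⟩ := abs_le.mp (hC x)
      rw [Real.norm_eq_abs, abs_le, birkhoffMax]
      rcases max_cases 0 (g x + birkhoffMax T g n (T x)) with h | h <;>
        constructor <;> linarith [h.1, h.2]
    · filter_upwards [hT.quasiMeasurePreserving.ae h] with x hx
      obtain ⟨N, hN⟩ := exists_nat_gt C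
      obtain ⟨n₀, hn₀⟩ := hx N
      refine tendsto_const_nhds.congr' ?_
      filter_upwards [eventually_ge_atTop n₀] with n hn
      have hmono := monotone_nat_of_le_succ (f := fun n => birkhoffMax T g n (T x))
        (fun n => birkhoffMax_le_succ n (T x)) hn
      have h1 := birkhoffSum_le_birkhoffMax (T := T) (g := g) n₀ (T x)
      have h2 := (abs_le.mp (hC x)).1
      dsimp only at hmono
      simp only [birkhoffMax]
      rw [max_eq_right (by linarith), add_sub_cancel_right]
  refine ge_of_tendsto' hlim fun n => ?_
  rw [integral_sub (hint (n + 1)) (hintT n), sub_nonneg]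
  have hcomp : ∫ x, birkhoffMax T g n (T x) ∂μ = ∫ x, birkhoffMax T g n x ∂μ := by
    have := integral_map (μ := μ) hT.aemeasurable (f := birkhoffMax T g n)
      (measurable_birkhoffMax hT.measurable hg n).aestronglyMeasurable
    rw [← this, hT.map_eq]
  rw [hcomp]
  exact integral_mono (hint n) (hint (n + 1)) (birkhoffMax_le_succ n)

lemma ae_birkhoffSum_bddAbove [IsProbabilityMeasure μ] (hT : Ergodic T μ) (hg : Measurable g)
    {C : ℝ} (hC : ∀ x, |g x| ≤ C) (hneg : ∫ x, g x ∂μ < 0) :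
    ∀ᵐ x ∂μ, ∃ N : ℕ, ∀ n, birkhoffSum T g n x ≤ N := by
  set E : Set α := {x | ∃ N : ℕ, ∀ n, birkhoffSum T g n x ≤ N} with hE
  have hEm : MeasurableSet E := by
    rw [hE]
    simp only [ofPred_exists, ofPred_forall]
    exact .iUnion fun N => .iInter fun n =>
      measurableSet_le (measurable_birkhoffSum hT.measurable hg n) measurable_const
  have hinv : T ⁻¹' E = E := by
    obtain ⟨K, hK⟩ := exists_nat_ge C
    ext x
    obtain ⟨h1, h2⟩ := abs_le.mp (hC x)
    constructor
    · rintro ⟨N, hN⟩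
      refine ⟨N + K, fun n => ?_⟩
      cases n with
      | zero => rw [birkhoffSum_zero]; positivity
      | succ n =>
        rw [birkhoffSum_succ']
        push_cast
        linarith [hN n]
    · rintro ⟨N, hN⟩
      refine ⟨N + K, fun n => ?_⟩
      have := hN (n + 1)
      rw [birkhoffSum_succ'] at this
      push_cast
      linarith
  rcases hT.toPreErgodic.ae_mem_or_ae_notMem hEm hinv with h | h
  · exact h
  · refine absurd (integral_nonneg_of_birkhoffSum_unbounded hT.toMeasurePreserving hg hC ?_)
      hneg.not_ge
    filter_upwards [h] with x hx
    simpa [hE] using hx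

lemma ae_eventually_birkhoffSum_div_le [IsProbabilityMeasure μ] (hT : Ergodic T μ)
    (hg : Measurable g) {C : ℝ} (hC : ∀ x, |g x| ≤ C) :
    ∀ᵐ x ∂μ, ∀ ε > 0, ∀ᶠ n : ℕ in atTop, birkhoffSum T g n x / n ≤ ∫ y, g y ∂μ + ε := by
  have hint : Integrable g μ := .of_bound hg.aestronglyMeasurable C (ae_of_all _ hC)
  have key (j : ℕ) : ∀ᵐ x ∂μ, ∃ N : ℕ, ∀ n,
      birkhoffSum T (fun y => g y - (∫ y, g y ∂μ + 1 / ((j : ℝ) + 1))) n x ≤ N := by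
    refine ae_birkhoffSum_bddAbove hT (hg.sub_const _)
      (C := C + |∫ y, g y ∂μ + 1 / ((j : ℝ) + 1)|)
      (fun x => (abs_sub _ _).trans (by gcongr; exact hC x)) ?_
    rw [integral_sub hint (integrable_const _)]
    simp only [integral_const, probReal_univ, one_smul]
    have : (0 : ℝ) < 1 / ((j : ℝ) + 1) := by positivity
    linarith
  filter_upwards [ae_all_iff.mpr key] with x hx ε hε
  obtain ⟨j, hj⟩ := exists_nat_one_div_lt (half_pos hε)
  obtain ⟨N, hN⟩ := hx j
  filter_upwards [(tendsto_const_div_atTop_nhds_zero_nat (N : ℝ)).eventually_lt_const (half_pos hε),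
    eventually_gt_atTop 0] with n hn hn0
  have hn0' : (0 : ℝ) < n := by exact_mod_cast hn0
  have hsum : birkhoffSum T (fun y => g y - (∫ y, g y ∂μ + 1 / ((j : ℝ) + 1))) n x =
      birkhoffSum T g n x - n * (∫ y, g y ∂μ + 1 / ((j : ℝ) + 1)) := by
    simp [birkhoffSum, mul_add]
  have h1 := hN n
  rw [hsum] at h1
  rw [div_lt_iff₀ hn0'] at hn
  rw [div_le_iff₀ hn0']
  nlinarith

/-- Birkhoff's pointwise ergodic theorem for bounded observables of an ergodic system. -/
theorem ae_tendsto_birkhoffSum_div [IsProbabilityMeasure μ] (hT : Ergodic T μ)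
    (hg : Measurable g) {C : ℝ} (hC : ∀ x, |g x| ≤ C) :
    ∀ᵐ x ∂μ, Tendsto (fun n : ℕ => birkhoffSum T g n x / n) atTop (𝓝 (∫ y, g y ∂μ)) := by
  filter_upwards [ae_eventually_birkhoffSum_div_le hT hg hC,
    ae_eventually_birkhoffSum_div_le hT hg.neg (C := C) (by simpa using hC)] with x h1 h2
  rw [Metric.tendsto_nhds]
  intro ε hε
  filter_upwards [h1 _ (half_pos hε), h2 _ (half_pos hε)] with n hn1 hn2
  rw [birkhoffSum_neg] at hn2
  simp only [Pi.neg_apply, integral_neg, neg_div] at hn2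
  rw [Real.dist_eq, abs_lt]
  constructor <;> linarith

end BirkhoffMax

lemma iterate_shift_apply {𝒳 : Type*} (ω : Path 𝒳) (t : ℕ) (i : ℤ) : shift^[t] ω i = ω (i + t) := by
  induction t generalizing ω with
  | zero => simp
  | succ t ih =>
    rw [Function.iterate_succ_apply, ih]
    simp only [shift]
    congr 1
    push_cast
    ring

/-- The cylinder set of paths along which the string `s` of length `m` ends at time `0`. -/
def cyl (m : ℕ) (s : ℕ → 𝒳) : Set (Path 𝒳) := {ω | ∀ j < m, ω (-(j : ℤ)) = s j}

/-- The number of times `0 ≤ t < n` at which the string `s` of length `m` ends. -/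
def occSum (ω : Path 𝒳) (m : ℕ) (s : ℕ → 𝒳) (n : ℕ) : ℝ :=
  birkhoffSum shift ((cyl m s).indicator fun _ => (1 : ℝ)) n ω

lemma iterate_shift_mem_cyl {𝒳 : Type*} {ω : Path 𝒳} {m : ℕ} {s : ℕ → 𝒳} {t : ℕ} :
    shift^[t] ω ∈ cyl m s ↔ OccursAt ω m s t := by
  simp only [cyl, OccursAt, mem_ofPred_eq, iterate_shift_apply]
  simp only [neg_add_eq_sub]

open Classical in
lemma occSum_succ {𝒳 : Type*} (ω : Path 𝒳) (m : ℕ) (s : ℕ → 𝒳) (n : ℕ) :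
    occSum ω m s (n + 1) = occSum ω m s n + if OccursAt ω m s n then 1 else 0 := by
  rw [occSum, birkhoffSum_succ, ← occSum, indicator_apply]
  simp only [iterate_shift_mem_cyl]

lemma cnt_eq_occSum_sub {𝒳 : Type*} (ω : Path 𝒳) (m : ℕ) (s : ℕ → 𝒳) {p q : ℕ} (h : p ≤ q) :
    (cnt ω m s p ((q : ℤ) - 1) : ℝ) = occSum ω m s q - occSum ω m s p := by
  classical
  induction q, h using Nat.le_induction with
  | base => simp [cnt]
  | succ q hq ih =>
    have hIcc : Finset.Icc (p : ℤ) (((q + 1 : ℕ) : ℤ) - 1) =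
        insert (q : ℤ) (Finset.Icc (p : ℤ) ((q : ℤ) - 1)) := by
      ext t
      simp only [Finset.mem_Icc, Finset.mem_insert]
      omega
    have hcnt : cnt ω m s p (((q + 1 : ℕ) : ℤ) - 1) =
        cnt ω m s p ((q : ℤ) - 1) + if OccursAt ω m s q then 1 else 0 := by
      unfold cnt
      rw [hIcc, Finset.filter_insert]
      split_ifs
      · rw [Finset.card_insert_of_notMem (by simp)]
      · rfl
    rw [hcnt, occSum_succ]
    push_cast
    rw [ih]
    ring

lemma cyl_congr {𝒳 : Type*} {m : ℕ} {s s' : ℕ → 𝒳} (h : ∀ j < m, s j = s' j) : cyl m s = cyl m s' := by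
  ext ω
  exact forall₂_congr fun j hj => by rw [h j hj]

variable {μ : Measure (Path 𝒳)}

lemma measurableSet_cyl [MeasurableSingletonClass 𝒳] (m : ℕ) (s : ℕ → 𝒳) :
    MeasurableSet (cyl m s) := by
  simp only [cyl, ofPred_forall]
  exact .iInter fun j => .iInter fun _ =>
    (measurableSet_singleton (s j)).preimage (measurable_pi_apply (-(j : ℤ)))

/-- Almost surely, every finite string occurs with its limiting frequency. -/
lemma ae_tendsto_occSum_div [Countable 𝒳] [MeasurableSingletonClass 𝒳]
    [IsProbabilityMeasure μ] (hErg : Ergodic (shift : Path 𝒳 → Path 𝒳) μ) :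
    ∀ᵐ ω ∂μ, ∀ m s, Tendsto (fun n : ℕ => occSum ω m s n / n) atTop (𝓝 (pstr μ m s)) := by
  have key (m : ℕ) (s : ℕ → 𝒳) :
      ∀ᵐ ω ∂μ, Tendsto (fun n : ℕ => occSum ω m s n / n) atTop (𝓝 (pstr μ m s)) := by
    have hlim := ae_tendsto_birkhoffSum_div hErg
      (measurable_const.indicator (measurableSet_cyl m s) : Measurable
        ((cyl m s).indicator fun _ => (1 : ℝ))) (C := 1) fun ω => by
        by_cases h : ω ∈ cyl m s <;> simp [h]
    rw [integral_indicator_const _ (measurableSet_cyl m s), smul_eq_mul, mul_one] at hlim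
    exact hlim
  have hne : Nonempty 𝒳 := by
    obtain ⟨ω⟩ := μ.nonempty_of_neZero
    exact ⟨ω 0⟩
  obtain ⟨x₀⟩ := hne
  let pad (m : ℕ) (s : Fin m → 𝒳) (j : ℕ) : 𝒳 := if h : j < m then s ⟨j, h⟩ else x₀
  filter_upwards [ae_all_iff.mpr fun m => ae_all_iff.mpr fun s : Fin m → 𝒳 => key m (pad m s)]
    with ω hω m s
  have hcyl : cyl m (pad m fun j => s j) = cyl m s := cyl_congr fun j hj => by simp [pad, hj]
  have hp : pstr μ m (pad m fun j => s j) = pstr μ m s := congrArg (fun A => (μ A).toReal) hcyl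
  have := hω m fun j => s j
  simpa only [hp, occSum, hcyl] using this

/-- Composing a sequence of Cesàro type with a time change that is linear up to a bounded error. -/
lemma tendsto_comp_div {S : ℕ → ℝ} {p r B : ℝ} {u : ℕ → ℕ}
    (hS : Tendsto (fun n : ℕ => S n / n) atTop (𝓝 p)) (hr : 0 < r)
    (hu : ∀ᶠ n : ℕ in atTop, |(u n : ℝ) - r * n| ≤ B) :
    Tendsto (fun n : ℕ => S (u n) / n) atTop (𝓝 (p * r)) := by
  have hlim : Tendsto (fun n : ℕ => (u n : ℝ) / n) atTop (𝓝 r) := by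
    rw [tendsto_iff_dist_tendsto_zero]
    refine squeeze_zero' (.of_forall fun _ => dist_nonneg) ?_
      (tendsto_const_div_atTop_nhds_zero_nat B)
    filter_upwards [hu, eventually_gt_atTop 0] with n hn hn0
    have hn' : (0 : ℝ) < n := by exact_mod_cast hn0
    rw [Real.dist_eq, div_sub' hn'.ne', abs_div, abs_of_pos hn', mul_comm (n : ℝ)]
    gcongr
  have hutop : Tendsto u atTop atTop := by
    rw [← tendsto_natCast_atTop_iff (R := ℝ)]
    refine (hlim.pos_mul_atTop hr tendsto_natCast_atTop_atTop).congr' ?_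
    filter_upwards [eventually_gt_atTop 0] with n hn0
    have hn' : (n : ℝ) ≠ 0 := by exact_mod_cast hn0.ne'
    field_simp
  refine ((hS.comp hutop).mul hlim).congr' ?_
  filter_upwards [hutop.eventually_gt_atTop 0] with n hn
  have : (u n : ℝ) ≠ 0 := by exact_mod_cast hn.ne'
  simp only [Function.comp_apply]
  field_simp

lemma tendsto_cnt_div {ω : Path 𝒳} {m : ℕ} {s : ℕ → 𝒳}
    (h : Tendsto (fun n : ℕ => occSum ω m s n / n) atTop (𝓝 (pstr μ m s)))
    {a b : ℕ → ℤ} {B : ℕ} (ha : ∀ n, |2 * a n - n| ≤ B) (hb : ∀ n, |b n - n| ≤ B) :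
    Tendsto (fun n : ℕ => (cnt ω m s (a n) (b n) : ℝ) / n) atTop (𝓝 (pstr μ m s / 2)) := by
  have hcast : ∀ᶠ n : ℕ in atTop, ((a n).toNat : ℤ) = a n ∧ ((b n + 1).toNat : ℤ) = b n + 1 ∧
      (a n).toNat ≤ (b n + 1).toNat := by
    filter_upwards [eventually_ge_atTop (3 * B)] with n hn
    have := abs_le.mp (ha n)
    have := abs_le.mp (hb n)
    omega
  have h1 := tendsto_comp_div h (r := 1) (B := B + 1) (u := fun n => (b n + 1).toNat) one_pos (by
    filter_upwards [hcast] with n hn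
    have h1 : (((b n + 1).toNat : ℤ) : ℝ) = ((b n + 1 : ℤ) : ℝ) := by rw [hn.2.1]
    have h2 : |((b n - n : ℤ) : ℝ)| ≤ B := by exact_mod_cast hb n
    push_cast at h1 h2
    rw [h1, abs_le] at *
    constructor <;> linarith)
  have h2 := tendsto_comp_div h (r := 1 / 2) (B := B) (u := fun n => (a n).toNat) one_half_pos (by
    filter_upwards [hcast] with n hn
    have h1 : (((a n).toNat : ℤ) : ℝ) = (a n : ℝ) := by rw [hn.1]
    have h2 : |((2 * a n - n : ℤ) : ℝ)| ≤ B := by exact_mod_cast ha n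
    push_cast at h1 h2
    rw [h1, abs_le] at *
    constructor <;> linarith)
  have h3 := h1.sub h2
  rw [show pstr μ m s * 1 - pstr μ m s * (1 / 2) = pstr μ m s / 2 by ring] at h3
  refine h3.congr' ?_
  filter_upwards [hcast] with n hn
  have := cnt_eq_occSum_sub ω m s hn.2.2
  rw [hn.1, hn.2.1, add_sub_cancel_right] at this
  rw [this, sub_div]

lemma OccursAt.of_withLast {𝒳 : Type*} {ω : Path 𝒳} {m : ℕ} {s : ℕ → 𝒳} {x : 𝒳} {t : ℤ}
    (h : OccursAt ω (m + 1) (withLast x s) t) : OccursAt ω m s (t - 1) := by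
  intro j hj
  have := h (j + 1) (by omega)
  simp only [withLast, Nat.add_eq_zero_iff, one_ne_zero, and_false, if_false,
    Nat.add_sub_cancel] at this
  rw [← this]
  congr 1
  push_cast
  ring

lemma empCond_nonneg {𝒳 : Type*} (ω : Path 𝒳) (n m : ℕ) (x : 𝒳) (s : ℕ → 𝒳) :
    0 ≤ empCond ω n m x s := by
  unfold empCond
  positivity

lemma empCond_le_one {𝒳 : Type*} (ω : Path 𝒳) (n m : ℕ) (x : 𝒳) (s : ℕ → 𝒳) :
    empCond ω n m x s ≤ 1 := by
  classical
  refine div_le_one_of_le₀ ?_ (Nat.cast_nonneg _)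
  refine Nat.cast_le.mpr (Finset.card_le_card_of_injOn (fun t => t - 1) ?_ fun _ _ _ _ h => by simpa using h)
  intro t ht
  simp only [Finset.coe_filter, Finset.mem_Icc, mem_ofPred_eq] at ht ⊢
  exact ⟨by omega, ht.2.of_withLast⟩

lemma pcond_eq [MeasurableSingletonClass 𝒳]
    (hμ : MeasurePreserving (shift : Path 𝒳 → Path 𝒳) μ μ) (m : ℕ) (x : 𝒳) (s : ℕ → 𝒳) :
    pcond μ m x s = pstr μ (m + 1) (withLast x s) / pstr μ m s := by
  have hset : {ω : Path 𝒳 | ω 1 = x ∧ ∀ j < m, ω (-(j : ℤ)) = s j} =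
      shift ⁻¹' cyl (m + 1) (withLast x s) := by
    ext ω
    simp only [mem_ofPred_eq, mem_preimage, cyl, shift, withLast]
    constructor
    · rintro ⟨h0, h⟩ (_ | j) hj
      · simpa using h0
      · simpa using h j (by omega)
    · intro h
      refine ⟨by simpa using h 0 (by omega), fun j hj => ?_⟩
      simpa using h (j + 1) (by omega)
  rw [pcond, hset, hμ.measure_preimage (measurableSet_cyl _ _).nullMeasurableSet]
  rfl

lemma pstr_pos_of_withLast [MeasurableSingletonClass 𝒳] [IsProbabilityMeasure μ]
    (hμ : MeasurePreserving (shift : Path 𝒳 → Path 𝒳) μ μ) {m : ℕ} {x : 𝒳} {s : ℕ → 𝒳}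
    (h : 0 < pstr μ (m + 1) (withLast x s)) : 0 < pstr μ m s := by
  refine h.trans_le ?_
  change μ.real (cyl (m + 1) (withLast x s)) ≤ μ.real (cyl m s)
  rw [← hμ.measureReal_preimage (measurableSet_cyl (m + 1) (withLast x s)).nullMeasurableSet]
  refine measureReal_mono fun ω hω j hj => ?_
  simpa [shift, withLast] using hω (j + 1) (by omega)

lemma pstr_anti [IsProbabilityMeasure μ] {m m' : ℕ} (h : m ≤ m') {s s' : ℕ → 𝒳}
    (hs : ∀ j < m, s j = s' j) : pstr μ m' s' ≤ pstr μ m s :=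
  ENNReal.toReal_mono (measure_ne_top _ _) <| measure_mono fun _ hω j hj =>
    (hω j (hj.trans_le h)).trans (hs j hj).symm

lemma abs_two_mul_half_add_sub_le (n : ℕ) (c : ℤ) :
    |2 * ((half n : ℤ) + c) - n| ≤ (1 + 2 * c.natAbs : ℕ) := by
  rw [abs_le]
  unfold half
  omega

lemma tendsto_empCond [MeasurableSingletonClass 𝒳]
    (hμ : MeasurePreserving (shift : Path 𝒳 → Path 𝒳) μ μ) {ω : Path 𝒳}
    (h : ∀ m s, Tendsto (fun n : ℕ => occSum ω m s n / n) atTop (𝓝 (pstr μ m s)))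
    {m : ℕ} {x : 𝒳} {s : ℕ → 𝒳} (hs : 0 < pstr μ m s) :
    Tendsto (fun n => empCond ω n m x s) atTop (𝓝 (pcond μ m x s)) := by
  have h1 := tendsto_cnt_div (h (m + 1) (withLast x s)) (a := fun n => half n + m) (b := fun n => n)
    (fun n => abs_two_mul_half_add_sub_le n m) fun n => by simp; positivity
  have h2 := tendsto_cnt_div (h m s) (a := fun n => half n + m - 1) (b := fun n => n - 1)
    (fun n => by simpa only [add_sub_assoc] using
      (abs_two_mul_half_add_sub_le n (m - 1)).trans (Int.ofNat_le.mpr (by omega : _ ≤ 3 + 2 * m)))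
    fun n => by simp; omega
  have h3 := h1.div h2 (by positivity)
  rw [div_div_div_cancel_right₀ two_ne_zero, ← pcond_eq hμ] at h3
  refine h3.congr' ?_
  filter_upwards [eventually_gt_atTop 0] with n hn
  have hn' : (n : ℝ) ≠ 0 := by exact_mod_cast hn.ne'
  rw [Pi.div_apply, div_div_div_cancel_right₀ hn']
  rfl

lemma eventually_inL {ω : Path 𝒳} {m : ℕ} {s : ℕ → 𝒳} {γ : ℝ} (hγ : 0 < γ)
    (h : Tendsto (fun n : ℕ => occSum ω (m + 1) s n / n) atTop (𝓝 (pstr μ (m + 1) s)))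
    (hs : 0 < pstr μ (m + 1) s) : ∀ᶠ n in atTop, inL γ ω n m s := by
  have hlim := tendsto_cnt_div h (a := fun n => half n + m) (b := fun n => n)
    (fun n => abs_two_mul_half_add_sub_le n m) fun n => by simp; positivity
  have hpow : Tendsto (fun n : ℕ => (n : ℝ) ^ (-γ)) atTop (𝓝 0) :=
    (tendsto_rpow_neg_atTop hγ).comp tendsto_natCast_atTop_atTop
  have hL2 : ∀ᶠ n in atTop, inL2 γ ω n m s := by
    filter_upwards [hpow.eventually_lt hlim (by positivity), eventually_gt_atTop 0] with n hn hn0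
    have hn' : (0 : ℝ) < n := by exact_mod_cast hn0
    rw [lt_div_iff₀ hn'] at hn
    refine lt_of_eq_of_lt ?_ hn
    rw [← Real.rpow_add_one hn'.ne', neg_add_eq_sub]
  classical
  obtain ⟨t, hmt, ht⟩ : ∃ t : ℤ, (m : ℤ) ≤ t ∧ OccursAt ω (m + 1) s t := by
    obtain ⟨n, hn⟩ := hL2.exists
    have hpos : 0 < cnt ω (m + 1) s ((half n : ℤ) + (m : ℤ)) n := by
      have : (0 : ℝ) < (cnt ω (m + 1) s ((half n : ℤ) + (m : ℤ)) n : ℝ) :=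
        (Real.rpow_nonneg (Nat.cast_nonneg n) _).trans_lt hn
      exact_mod_cast this
    obtain ⟨t, ht⟩ := Finset.card_pos.mp hpos
    simp only [Finset.mem_filter, Finset.mem_Icc] at ht
    exact ⟨t, by omega, ht.2⟩
  filter_upwards [hL2, eventually_ge_atTop (2 * (t.toNat + 1))] with n hn hnt
  exact ⟨⟨t, hmt, by unfold half; omega, ht⟩, hn⟩

/-- The set of values over which `hatDelta` takes its supremum. -/
def hatDeltaSet {𝒳 : Type*} (γ : ℝ) (ω : Path 𝒳) (b : ℕ → 𝒳) (n k : ℕ) : Set ℝ :=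
  {d : ℝ | ∃ i : ℕ, 1 ≤ i ∧ i ≤ n ∧ ∃ z : ℕ → 𝒳, ∃ x : 𝒳,
    inL γ ω n (k + i) (withLast x (prependOld b k z)) ∧
    d = |empCond ω n k x b - empCond ω n (k + i) x (prependOld b k z)|}

lemma hatDeltaSet_subset_Icc {𝒳 : Type*} (γ : ℝ) (ω : Path 𝒳) (b : ℕ → 𝒳) (n k : ℕ) :
    hatDeltaSet γ ω b n k ⊆ Icc 0 1 := by
  rintro _ ⟨i, -, -, z, x, -, rfl⟩
  refine ⟨abs_nonneg _, abs_sub_le_of_nonneg_of_le ?_ ?_ ?_ ?_⟩ <;>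
    first | exact empCond_nonneg .. | exact empCond_le_one ..

lemma hatDelta_mem_Icc {𝒳 : Type*} (γ : ℝ) (l : ℕ → ℕ) (ω : Path 𝒳) (n k : ℕ) :
    hatDelta γ l ω n k ∈ Icc (0 : ℝ) 1 := by
  have hsub := hatDeltaSet_subset_Icc γ ω (tildePast l ω) n k
  change (if _ then (1 : ℝ) else 0) * sSup (hatDeltaSet γ ω (tildePast l ω) n k) ∈ _
  have h0 : 0 ≤ sSup (hatDeltaSet γ ω (tildePast l ω) n k) :=
    Real.sSup_nonneg fun d hd => (hsub hd).1
  have h1 : sSup (hatDeltaSet γ ω (tildePast l ω) n k) ≤ 1 :=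
    Real.sSup_le (fun d hd => (hsub hd).2) zero_le_one
  split_ifs
  · rw [one_mul]
    exact ⟨h0, h1⟩
  · simp

/-- equation (3). For every fixed `k`, almost surely
`liminf_n Δ̂_k^n ≥ Δ_k`. -/
theorem statement6
    {𝒳 : Type*} [Countable 𝒳] [MeasurableSpace 𝒳] [MeasurableSingletonClass 𝒳]
    (μ : Measure (Path 𝒳)) [IsProbabilityMeasure μ]
    (hErg : Ergodic (shift : Path 𝒳 → Path 𝒳) μ)
    (l : ℕ → ℕ) (hl1 : l 1 = 1) (hlmono : Monotone l)
    (hlle : ∀ k, 1 ≤ k → l k ≤ k) (hltop : Tendsto l atTop atTop)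
    (γ : ℝ) (hγ0 : 0 < γ) (hγ1 : γ < 1) (k : ℕ) :
    ∀ᵐ ω ∂μ,
      Delta μ k (tildePast l ω) ≤
        Filter.liminf (fun n : ℕ => hatDelta γ l ω n k) atTop := by
  have hμ := hErg.toMeasurePreserving
  filter_upwards [ae_tendsto_occSum_div hErg] with ω hω
  have hcobdd : IsCoboundedUnder (· ≥ ·) atTop fun n : ℕ => hatDelta γ l ω n k :=
    IsBoundedUnder.isCoboundedUnder_ge
      (isBoundedUnder_of ⟨1, fun n => (hatDelta_mem_Icc γ l ω n k).2⟩)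
  refine Real.sSup_le ?_ (le_liminf_of_le hcobdd (.of_forall fun n =>
    (hatDelta_mem_Icc γ l ω n k).1))
  rintro _ ⟨i, hi, z, x, hpos, rfl⟩
  have hpos' := pstr_pos_of_withLast hμ hpos
  have hpos'' : 0 < pstr μ k (tildePast l ω) :=
    hpos'.trans_le (pstr_anti (Nat.le_add_right k i) fun j hj => by simp [prependOld, hj])
  have hlim := ((tendsto_empCond hμ hω (x := x) hpos'').sub
    (tendsto_empCond hμ hω (x := x) hpos')).abs
  rw [← hlim.liminf_eq]
  refine liminf_le_liminf ?_ hlim.isBoundedUnder_ge hcobdd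
  filter_upwards [eventually_inL hγ0 (hω _ _) hpos, eventually_ge_atTop i,
    eventually_ge_atTop (2 * ((zeta l ω (Jfun l k)).toNat + 1))] with n hn hin hnz
  rw [hatDelta, if_pos (by unfold half; omega), one_mul]
  exact le_csSup ⟨1, fun d hd => (hatDeltaSet_subset_Icc γ ω (tildePast l ω) n k hd).2⟩
    ⟨i, hi, hin, z, x, hn, rfl⟩

end MWPrediction
end
end
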